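/- Let a,h,d be positive integers with gcd(a,d)=1, a ≥ 27 and h ≥ ⌈d/3⌉. Let A(a) = (a, ha+d, ha+5d, ha+9d) and write j = a mod 9. Then: g(A(a)) = (6h−1)a + 26d + (ha+9d)(⌊a/9⌋ − 3) if j ∈ {0,1,2,3}; g(A(a)) = (6h−1)a + 30d + (ha+9d)(⌊a/9⌋ − 3) if j = 4; g(A(a)) = (7h−1)a + 31d + (ha+9d)(⌊a/9⌋ − 3) if j ∈ {5,6,7,8}. -/

import Mathlib

/-- The least number of coins with values `1`, `5`, `9` that add up to `n`, as given by the greedy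
algorithm. -/
def coinCount (n : ℕ) : ℕ := n / 9 + n % 9 / 5 + n % 9 % 5

theorem coinCount_le (x y z : ℕ) : coinCount (x + 5 * y + 9 * z) ≤ x + y + z := by
  have add_one : ∀ n, coinCount (n + 1) ≤ coinCount n + 1 := by
    intro n; unfold coinCount; omega
  have add_five : ∀ n, coinCount (n + 5) ≤ coinCount n + 1 := by
    intro n; unfold coinCount; omega
  have add_nine : ∀ n, coinCount (n + 9) ≤ coinCount n + 1 := by
    intro n; unfold coinCount; omega
  induction z with
  | succ z ih => exact (add_nine (x + 5 * y + 9 * z)).trans (by omega)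
  | zero =>
    induction y with
    | succ y ih =>
      have := add_five (x + 5 * y)
      rw [show x + 5 * (y + 1) + 9 * 0 = x + 5 * y + 5 by ring]
      simp only [mul_zero, add_zero] at ih ⊢
      omega
    | zero =>
      induction x with
      | succ x ih =>
        have := add_one x
        simp only [mul_zero, add_zero] at ih ⊢
        omega
      | zero => simp [coinCount]

theorem coinCount_le_add_mul {a : ℕ} (ha : 27 ≤ a) (n m : ℕ) :
    coinCount n ≤ coinCount (n + m * a) := by
  induction m with
  | zero => simp
  | succ m ih =>
    refine ih.trans ?_
    rw [add_mul, one_mul, ← add_assoc]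
    generalize n + m * a = k
    unfold coinCount
    omega

/-- If `r` maximises the least representable element `h * a * coinCount r + r * d` of the residue
class of `r * d` modulo `a`, then the Frobenius number is that element minus `a`. -/
theorem isGreatest_nonrepresentable {a h d r : ℕ} (hgcd : Nat.gcd a d = 1) (ha : 27 ≤ a)
    (hr : r < a)
    (hmax : ∀ s < a, h * a * coinCount s + s * d ≤ h * a * coinCount r + r * d) :
    IsGreatest {n : ℤ | ¬ ∃ x0 x1 x2 x3 : ℕ,
        n = ((x0 * a + x1 * (h * a + d) + x2 * (h * a + 5 * d)
          + x3 * (h * a + 9 * d) : ℕ) : ℤ)}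
      ((h : ℤ) * a * coinCount r + r * d - a) := by
  have ha0 : (0 : ℤ) < a := by omega
  have hcop : IsCoprime (a : ℤ) (d : ℤ) := Nat.isCoprime_iff_coprime.mpr hgcd
  constructor
  · rintro ⟨x0, x1, x2, x3, hx⟩
    push_cast at hx
    have hdvd : (a : ℤ) ∣ ((x1 : ℤ) + 5 * x2 + 9 * x3 - r) * d :=
      ⟨h * coinCount r - 1 - x0 - (x1 + x2 + x3) * h, by linear_combination -hx⟩
    obtain ⟨m, hm⟩ := hcop.dvd_of_dvd_mul_right hdvd
    have hm0 : 0 ≤ m := by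
      by_contra! hneg
      nlinarith
    lift m to ℕ using hm0
    have hsum : x1 + 5 * x2 + 9 * x3 = r + m * a := by
      zify
      linear_combination hm
    have hcount : coinCount r ≤ x1 + x2 + x3 := by
      have := coinCount_le x1 x2 x3
      rw [hsum] at this
      exact (coinCount_le_add_mul ha r m).trans this
    have hcancel : (a : ℤ) * (x0 + (x1 + x2 + x3) * h + m * d) = a * (h * coinCount r - 1) := by
      linear_combination -hx - d * hm
    have heq := mul_left_cancel₀ ha0.ne' hcancel
    have hle : (h : ℤ) * coinCount r ≤ h * (x1 + x2 + x3) := by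
      exact_mod_cast Nat.mul_le_mul_left h hcount
    have : (0 : ℤ) ≤ m * d := by positivity
    linarith [Int.natCast_nonneg x0]
  · intro n hn
    by_contra! hlt
    refine hn ?_
    obtain ⟨u, v, huv⟩ := hcop
    have hs0 := Int.emod_nonneg (n * v) ha0.ne'
    have hsa := Int.emod_lt_of_pos (n * v) ha0
    have hdiv := Int.emod_add_mul_ediv (n * v) a
    generalize n * v / a = q at hdiv
    generalize n * v % a = s at hs0 hsa hdiv
    lift s to ℕ using hs0
    have hs := hmax s (by exact_mod_cast hsa)
    zify at hs
    obtain ⟨t, ht⟩ : ∃ t : ℤ, n = h * a * coinCount s + s * d + a * t :=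
      ⟨n * u + q * d - h * coinCount s, by linear_combination -n * huv - d * hdiv⟩
    have ht0 : 0 ≤ t := by
      by_contra! hneg
      nlinarith
    lift t to ℕ using ht0
    refine ⟨t, s % 9 % 5, s % 9 / 5, s / 9, ?_⟩
    rw [ht]
    norm_cast
    have hs9 : s = s % 9 % 5 + 5 * (s % 9 / 5) + 9 * (s / 9) := by omega
    have hc : coinCount s = s % 9 % 5 + s % 9 / 5 + s / 9 := by
      unfold coinCount
      omega
    generalize s % 9 % 5 = x at *
    generalize s % 9 / 5 = y at *
    generalize s / 9 = z at *
    rw [hc, hs9]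
    ring

theorem maximal_of_coinCount {a h d r : ℕ} (hda : 3 * d ≤ h * a)
    (hr : ∀ s < a, s ≤ r ∧ coinCount s ≤ coinCount r ∨
      s ≤ r + 3 ∧ coinCount s + 1 ≤ coinCount r) :
    ∀ s < a, h * a * coinCount s + s * d ≤ h * a * coinCount r + r * d := by
  intro s hs
  rcases hr s hs with ⟨h1, h2⟩ | ⟨h1, h2⟩
  · gcongr
  · have h3 := Nat.mul_le_mul_left (h * a) h2
    have h4 := Nat.mul_le_mul_right d h1
    linarith

theorem stmt_19 (a h d : ℕ) (ha : 0 < a) (hh : 0 < h) (hd : 0 < d)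
    (hgcd : Nat.gcd a d = 1) (ha' : 27 ≤ a) (hhd : d ⌈/⌉ 3 ≤ h) :
    (a % 9 ≤ 3 →
      IsGreatest {n : ℤ | ¬ ∃ x0 x1 x2 x3 : ℕ,
        n = ((x0 * a + x1 * (h * a + d) + x2 * (h * a + 5 * d)
          + x3 * (h * a + 9 * d) : ℕ) : ℤ)}
        ((6 * (h : ℤ) - 1) * a + 26 * d + ((h : ℤ) * a + 9 * d) * (((a / 9 : ℕ) : ℤ) - 3))) ∧
    (a % 9 = 4 →
      IsGreatest {n : ℤ | ¬ ∃ x0 x1 x2 x3 : ℕ,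
        n = ((x0 * a + x1 * (h * a + d) + x2 * (h * a + 5 * d)
          + x3 * (h * a + 9 * d) : ℕ) : ℤ)}
        ((6 * (h : ℤ) - 1) * a + 30 * d + ((h : ℤ) * a + 9 * d) * (((a / 9 : ℕ) : ℤ) - 3))) ∧
    (5 ≤ a % 9 →
      IsGreatest {n : ℤ | ¬ ∃ x0 x1 x2 x3 : ℕ,
        n = ((x0 * a + x1 * (h * a + d) + x2 * (h * a + 5 * d)
          + x3 * (h * a + 9 * d) : ℕ) : ℤ)}
        ((7 * (h : ℤ) - 1) * a + 31 * d + ((h : ℤ) * a + 9 * d) * (((a / 9 : ℕ) : ℤ) - 3))) := by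
  have hda : 3 * d ≤ h * a := by
    have h1 : d ≤ 3 * h := (ceilDiv_le_iff_le_mul (by norm_num)).mp hhd
    nlinarith
  refine ⟨fun hj => ?_, fun hj => ?_, fun hj => ?_⟩
  · have key := isGreatest_nonrepresentable (r := 9 * (a / 9) - 1) hgcd ha' (by omega)
      (maximal_of_coinCount hda fun s hs => by unfold coinCount; omega)
    have hc : coinCount (9 * (a / 9) - 1) = a / 9 + 3 := by unfold coinCount; omega
    rw [hc, Nat.cast_sub (by omega)] at key
    convert key using 1
    push_cast
    ring
  · have key := isGreatest_nonrepresentable (r := 9 * (a / 9) + 3) hgcd ha' (by omega)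
      (maximal_of_coinCount hda fun s hs => by unfold coinCount; omega)
    have hc : coinCount (9 * (a / 9) + 3) = a / 9 + 3 := by unfold coinCount; omega
    rw [hc] at key
    convert key using 1
    push_cast
    ring
  · have key := isGreatest_nonrepresentable (r := 9 * (a / 9) + 4) hgcd ha' (by omega)
      (maximal_of_coinCount hda fun s hs => by unfold coinCount; omega)
    have hc : coinCount (9 * (a / 9) + 4) = a / 9 + 4 := by unfold coinCount; omega
    rw [hc] at key
    convert key using 1
    push_cast
    ring
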